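/- arXiv:1911.02429 — 2 statements merged into one kernel-verified Lean document; each statement's English description precedes it below -/
import Mathlib

section
/- Let (H, m, u, Δ, ε) be a bialgebra over a commutative ring k, where u : k → H is the unit map (u(a) = a·1_H) and ε : H → k is the counit. Suppose there are k-submodules H^n (n ≥ 0) such that H = ⋃_{n≥0} H^n, H^n ⊆ H^{n+1} for all n, Δ(H^n) ⊆ Σ_{p+q=n} (image of H^p ⊗ H^q in H ⊗ H) for all n, H^n = im u + (H^n ∩ ker ε) for all n, and H^0 = im u (i.e., (H, Δ, ε, u) is a connected coaugmented cofiltered coalgebra). Then H is a Hopf algebra: there exists a k-linear map S : H → H such that m ∘ (S ⊗ id_H) ∘ Δ = u ∘ ε and m ∘ (id_H ⊗ S) ∘ Δ = u ∘ ε. -/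
open TensorProduct

/-- The image of `P ⊗ Q` in `H ⊗ H`, for submodules `P Q : Submodule k H`. -/
noncomputable def tensorImage {k H : Type*} [CommRing k] [AddCommGroup H] [Module k H]
    (P Q : Submodule k H) : Submodule k (H ⊗[k] H) :=
  LinearMap.range (TensorProduct.map P.subtype Q.subtype)

/-- The value of a convolution product at `x` with `Δ x ∈ Σ_{p+q=n} Fᵖ ⊗ Fᵠ` depends only on the
products of the values of the two factors on `Fᵖ` and `Fᵠ` for `p + q = n`. -/
lemma convMul_apply_congr {k H : Type*} [CommRing k] [Ring H] [Bialgebra k H]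
    {F : ℕ → Submodule k H} {n : ℕ} {x : H}
    (hx : Coalgebra.comul x ∈ ⨆ (p : ℕ) (q : ℕ) (_ : p + q = n), tensorImage (F p) (F q))
    {f f' g g' : WithConv (H →ₗ[k] H)}
    (h : ∀ p q, p + q = n → ∀ a ∈ F p, ∀ b ∈ F q, f a * g b = f' a * g' b) :
    (f * g) x = (f' * g') x := by
  have hle : (⨆ (p : ℕ) (q : ℕ) (_ : p + q = n), tensorImage (F p) (F q)) ≤
      LinearMap.eqLocus (LinearMap.mul' k H ∘ₗ TensorProduct.map f.ofConv g.ofConv)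
        (LinearMap.mul' k H ∘ₗ TensorProduct.map f'.ofConv g'.ofConv) := by
    refine iSup_le fun p => iSup_le fun q => iSup_le fun hpq => ?_
    rintro _ ⟨t, rfl⟩
    induction t with
    | zero => simp
    | tmul a b => exact h p q hpq a a.2 b b.2
    | add s t hs ht => rw [map_add]; exact add_mem hs ht
  exact hle hx

/-- A linear endomorphism killing `F⁰` is locally nilpotent for convolution: its `n`-th power
kills `Fᵐ` for all `m < n`. -/
lemma convPow_apply_eq_zero {k H : Type*} [CommRing k] [Ring H] [Bialgebra k H]
    {F : ℕ → Submodule k H}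
    (hcomul : ∀ n, ∀ x ∈ F n, Coalgebra.comul x ∈
      ⨆ (p : ℕ) (q : ℕ) (_ : p + q = n), tensorImage (F p) (F q))
    {g : WithConv (H →ₗ[k] H)} (hg : ∀ x ∈ F 0, g x = 0) (n : ℕ) :
    ∀ m < n, ∀ x ∈ F m, (g ^ n) x = 0 := by
  induction n with
  | zero => intro m hm; omega
  | succ n ih =>
    intro m hm x hx
    have key : (g * g ^ n) x = ((0 : WithConv (H →ₗ[k] H)) * 0) x := by
      refine convMul_apply_congr (hcomul m x hx) fun p q hpq a ha b hb => ?_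
      rcases Nat.eq_zero_or_pos p with rfl | hp
      · simp [hg a ha]
      · simp [ih q (by omega) b hb]
    rw [pow_succ', key, mul_zero]
    rfl

/-- A sequence of linear maps that is eventually constant on each step of an exhaustive
increasing filtration has a linear limit. -/
lemma exists_linearMap_eq_on_filtration {k M N : Type*} [CommRing k] [AddCommGroup M]
    [Module k M] [AddCommGroup N] [Module k N] {F : ℕ → Submodule k M} (hF : Monotone F)
    (hexh : ∀ x : M, ∃ n, x ∈ F n) (T : ℕ → M →ₗ[k] N)
    (hT : ∀ n, ∀ m, n ≤ m → ∀ x ∈ F n, T m x = T n x) :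
    ∃ S : M →ₗ[k] N, ∀ n, ∀ x ∈ F n, S x = T n x := by
  choose d hd using hexh
  have key : ∀ n, ∀ x ∈ F n, T (d x) x = T n x := fun n x hx => by
    rw [← hT n (max n (d x)) (le_max_left _ _) x hx,
      hT (d x) (max n (d x)) (le_max_right _ _) x (hd x)]
  refine ⟨{ toFun := fun x => T (d x) x, map_add' := fun x y => ?_,
            map_smul' := fun c x => ?_ }, key⟩
  · have hx := hF (le_max_left (d x) (d y)) (hd x)
    have hy := hF (le_max_right (d x) (d y)) (hd y)
    rw [key _ _ (add_mem hx hy), key _ x hx, key _ y hy, map_add]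
  · rw [key _ _ ((F (d x)).smul_mem c (hd x)), map_smul, RingHom.id_apply]

/-- Let `(H, m, u, Δ, ε)` be a bialgebra over a commutative ring `k` whose
underlying coaugmented coalgebra (with coaugmentation the unit map `u`) is connected
cofiltered, via submodules `(Hⁿ)ₙ` with `H = ⋃ₙ Hⁿ`, `Hⁿ ⊆ Hⁿ⁺¹`,
`Δ(Hⁿ) ⊆ Σ_{p+q=n} (image of Hᵖ ⊗ Hᵠ)`, `Hⁿ = im u + (Hⁿ ∩ ker ε)` and `H⁰ = im u`.
Then `H` is a Hopf algebra: there is a `k`-linear `S : H → H` with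
`m ∘ (S ⊗ id) ∘ Δ = u ∘ ε` and `m ∘ (id ⊗ S) ∘ Δ = u ∘ ε`. -/
theorem hopf_of_connected_cofiltered_bialgebra
    {k H : Type*} [CommRing k] [Ring H] [Bialgebra k H]
    (F : ℕ → Submodule k H)
    (hexh : ∀ x : H, ∃ n, x ∈ F n)
    (hmono : ∀ n, F n ≤ F (n + 1))
    (hcomul : ∀ n, ∀ x ∈ F n, Coalgebra.comul x ∈
      ⨆ (p : ℕ) (q : ℕ) (_ : p + q = n), tensorImage (F p) (F q))
    (hsplit : ∀ n, F n = LinearMap.range (Algebra.linearMap k H) ⊔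
      (F n ⊓ LinearMap.ker (Coalgebra.counit (R := k) (A := H))))
    (hconn : F 0 = LinearMap.range (Algebra.linearMap k H)) :
    ∃ S : H →ₗ[k] H,
      LinearMap.mul' k H ∘ₗ TensorProduct.map S LinearMap.id ∘ₗ Coalgebra.comul
        = Algebra.linearMap k H ∘ₗ Coalgebra.counit ∧
      LinearMap.mul' k H ∘ₗ TensorProduct.map LinearMap.id S ∘ₗ Coalgebra.comul
        = Algebra.linearMap k H ∘ₗ Coalgebra.counit := by
  have hF : Monotone F := monotone_nat_of_le_succ hmono
  let I : WithConv (H →ₗ[k] H) := WithConv.toConv LinearMap.id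
  let g : WithConv (H →ₗ[k] H) := 1 - I
  have hI : I = 1 - g := by simp [g]
  have hg : ∀ x ∈ F 0, g x = 0 := by
    intro x hx
    rw [hconn] at hx
    obtain ⟨a, rfl⟩ := hx
    change (1 : WithConv (H →ₗ[k] H)) (Algebra.linearMap k H a) - Algebra.linearMap k H a = 0
    simp
  have hnil := convPow_apply_eq_zero hcomul hg
  let T : ℕ → WithConv (H →ₗ[k] H) := fun n => ∑ i ∈ Finset.range (n + 1), g ^ i
  have hT : ∀ n, ∀ m, n ≤ m → ∀ x ∈ F n, T m x = T n x := by
    intro n m hnm x hx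
    induction m, hnm using Nat.le_induction with
    | base => rfl
    | succ m hnm ih =>
      have hsucc : T (m + 1) = T m + g ^ (m + 1) := Finset.sum_range_succ _ _
      rw [hsucc]
      change T m x + (g ^ (m + 1)) x = T n x
      rw [hnil (m + 1) n (by omega) x hx, add_zero, ih]
  obtain ⟨S, hS⟩ := exists_linearMap_eq_on_filtration hF hexh (fun n => (T n).ofConv) hT
  have hST : ∀ n, ∀ p ≤ n, ∀ a ∈ F p, S a = T n a := fun n p hp a ha => hS n a (hF hp ha)
  have hone : ∀ n, ∀ x ∈ F n, (1 - g ^ (n + 1)) x = (1 : WithConv (H →ₗ[k] H)) x := by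
    intro n x hx
    change (1 : WithConv (H →ₗ[k] H)) x - (g ^ (n + 1)) x = _
    rw [hnil (n + 1) n (by omega) x hx, sub_zero]
  refine ⟨S, LinearMap.ext fun x => ?_, LinearMap.ext fun x => ?_⟩
  · obtain ⟨n, hx⟩ := hexh x
    change (WithConv.toConv S * I) x = (1 : WithConv (H →ₗ[k] H)) x
    rw [← hone n x hx, ← geom_sum_mul_neg, ← hI]
    refine convMul_apply_congr (hcomul n x hx) fun p q hpq a ha b _ => ?_
    exact congrArg (· * I b) (hST n p (by omega) a ha)
  · obtain ⟨n, hx⟩ := hexh x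
    change (I * WithConv.toConv S) x = (1 : WithConv (H →ₗ[k] H)) x
    rw [← hone n x hx, ← mul_neg_geom_sum, ← hI]
    refine convMul_apply_congr (hcomul n x hx) fun p q hpq a _ b hb => ?_
    exact congrArg (I a * ·) (hST n q (by omega) b hb)
end

section
/- Let (H, m, u, Δ, ε) be a bialgebra over a commutative ring k, where u is the unit map of H. Suppose there are k-submodules H^(n) (n ≥ 0) forming an internal direct sum decomposition H = ⊕_{n≥0} H^(n) such that Δ(H^(n)) ⊆ Σ_{p+q=n} (image of H^(p) ⊗ H^(q) in H ⊗ H) for all n, Σ_{n≥1} H^(n) ⊆ ker ε, and H^(0) = im u (i.e., (H, Δ, ε, u) is a connected coaugmented cograded coalgebra). Then H is a Hopf algebra: there exists a k-linear map S : H → H such that m ∘ (S ⊗ id_H) ∘ Δ = u ∘ ε and m ∘ (id_H ⊗ S) ∘ Δ = u ∘ ε. -/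
open TensorProduct

/-- Linear maps out of `H ⊗ H` that agree on `𝒞 p ⊗ 𝒞 q` for all `p + q = n` agree on every
coproduct lying in the degree `n` part of `H ⊗ H`. -/
theorem linearMap_eq_of_mem_iSup_tensorImage
    {k H M : Type*} [CommRing k] [AddCommGroup H] [Module k H] [AddCommGroup M] [Module k M]
    {𝒞 : ℕ → Submodule k H} {n : ℕ} {t : H ⊗[k] H}
    (ht : t ∈ ⨆ (p : ℕ) (q : ℕ) (_ : p + q = n), tensorImage (𝒞 p) (𝒞 q))
    (φ ψ : H ⊗[k] H →ₗ[k] M)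
    (h : ∀ p q, p + q = n → ∀ a ∈ 𝒞 p, ∀ b ∈ 𝒞 q, φ (a ⊗ₜ b) = ψ (a ⊗ₜ b)) :
    φ t = ψ t := by
  suffices hle : (⨆ (p : ℕ) (q : ℕ) (_ : p + q = n), tensorImage (𝒞 p) (𝒞 q)) ≤
      LinearMap.eqLocus φ ψ from hle ht
  refine iSup_le fun p => iSup_le fun q => iSup_le fun hpq => ?_
  rintro _ ⟨s, rfl⟩
  induction s with
  | zero => simp
  | tmul a b => exact h p q hpq a a.2 b b.2
  | add s t hs ht => rw [map_add]; exact add_mem hs ht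

/-- Convolution products in degree `n` depend only on the values of the factors in bidegrees
`(p, q)` with `p + q = n`. -/
theorem convMul_apply_eq_of_mem
    {k H : Type*} [CommRing k] [Ring H] [Bialgebra k H] {𝒞 : ℕ → Submodule k H}
    (hcomul : ∀ n, ∀ x ∈ 𝒞 n, Coalgebra.comul x ∈
      ⨆ (p : ℕ) (q : ℕ) (_ : p + q = n), tensorImage (𝒞 p) (𝒞 q))
    {n : ℕ} {x : H} (hx : x ∈ 𝒞 n) (f g f' g' : WithConv (H →ₗ[k] H))
    (h : ∀ p q, p + q = n → ∀ a ∈ 𝒞 p, ∀ b ∈ 𝒞 q, f a * g b = f' a * g' b) :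
    (f * g) x = (f' * g') x := by
  rw [LinearMap.convMul_apply, LinearMap.convMul_apply]
  refine linearMap_eq_of_mem_iSup_tensorImage (hcomul n x hx)
    (LinearMap.mul' k H ∘ₗ TensorProduct.map f.ofConv g.ofConv)
    (LinearMap.mul' k H ∘ₗ TensorProduct.map f'.ofConv g'.ofConv) fun p q hpq a ha b hb => ?_
  simpa using h p q hpq a ha b hb

/-- If `e` vanishes in degree `0`, then its `N`-th convolution power vanishes in degrees
below `N`. -/
theorem convPow_apply_eq_zero_of_lt
    {k H : Type*} [CommRing k] [Ring H] [Bialgebra k H] {𝒞 : ℕ → Submodule k H}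
    (hcomul : ∀ n, ∀ x ∈ 𝒞 n, Coalgebra.comul x ∈
      ⨆ (p : ℕ) (q : ℕ) (_ : p + q = n), tensorImage (𝒞 p) (𝒞 q))
    {e : WithConv (H →ₗ[k] H)} (he : ∀ x ∈ 𝒞 0, e x = 0)
    {N n : ℕ} (hn : n < N) {x : H} (hx : x ∈ 𝒞 n) : (e ^ N) x = 0 := by
  induction N generalizing n x with
  | zero => omega
  | succ N ih =>
    rw [pow_succ, convMul_apply_eq_of_mem hcomul hx (e ^ N) e 0 0]
    · simp
    · intro p q hpq a ha b hb
      rcases Nat.eq_zero_or_pos q with rfl | hq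
      · simp [he b hb]
      · simp [ih (by omega : p < N) ha]

/-- A linear map can be prescribed on each summand of an internal direct sum. -/
theorem exists_linearMap_eq_on_isInternal
    {k H M : Type*} [CommRing k] [AddCommGroup H] [Module k H] [AddCommGroup M] [Module k M]
    {𝒞 : ℕ → Submodule k H} (h : DirectSum.IsInternal 𝒞) (f : ℕ → H →ₗ[k] M) :
    ∃ S : H →ₗ[k] M, ∀ n, ∀ x ∈ 𝒞 n, S x = f n x := by
  let E := LinearEquiv.ofBijective (DirectSum.coeLinearMap 𝒞) h
  refine ⟨DirectSum.toModule k ℕ M (fun n => f n ∘ₗ (𝒞 n).subtype) ∘ₗ E.symm.toLinearMap,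
    fun n x hx => ?_⟩
  have hE : E.symm x = DirectSum.lof k ℕ (fun i => 𝒞 i) n ⟨x, hx⟩ := by
    rw [LinearEquiv.symm_apply_eq]
    exact (DirectSum.coeLinearMap_lof 𝒞 n ⟨x, hx⟩).symm
  simp [hE, DirectSum.toModule_lof]

/-- Linear maps agreeing on each summand of an internal direct sum are equal. -/
theorem linearMap_ext_of_isInternal
    {k H M : Type*} [CommRing k] [AddCommGroup H] [Module k H] [AddCommGroup M] [Module k M]
    {𝒞 : ℕ → Submodule k H} (h : DirectSum.IsInternal 𝒞) {f g : H →ₗ[k] M}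
    (hfg : ∀ n, ∀ x ∈ 𝒞 n, f x = g x) : f = g := by
  have hle : (⨆ n, 𝒞 n) ≤ LinearMap.eqLocus f g := iSup_le hfg
  rw [h.submodule_iSup_eq_top] at hle
  exact LinearMap.ext fun x => hle Submodule.mem_top

/-- Let `(H, m, u, Δ, ε)` be a bialgebra over a commutative ring `k` whose
underlying coaugmented coalgebra (with coaugmentation the unit map `u`) is connected
cograded: there are submodules `(H⁽ⁿ⁾)ₙ` with `H = ⊕_{n≥0} H⁽ⁿ⁾` internally,
`Δ(H⁽ⁿ⁾) ⊆ Σ_{p+q=n} (image of H⁽ᵖ⁾ ⊗ H⁽ᵠ⁾)`, `Σ_{n≥1} H⁽ⁿ⁾ ⊆ ker ε`, and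
`H⁽⁰⁾ = im u`. Then `H` is a Hopf algebra: there is a `k`-linear `S : H → H` with
`m ∘ (S ⊗ id) ∘ Δ = u ∘ ε` and `m ∘ (id ⊗ S) ∘ Δ = u ∘ ε`. -/
theorem hopf_of_connected_cograded_bialgebra
    {k H : Type*} [CommRing k] [Ring H] [Bialgebra k H]
    (𝒞 : ℕ → Submodule k H)
    (hinternal : DirectSum.IsInternal 𝒞)
    (hcomul : ∀ n, ∀ x ∈ 𝒞 n, Coalgebra.comul x ∈
      ⨆ (p : ℕ) (q : ℕ) (_ : p + q = n), tensorImage (𝒞 p) (𝒞 q))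
    (hker : (⨆ (n : ℕ) (_ : 1 ≤ n), 𝒞 n) ≤
      LinearMap.ker (Coalgebra.counit (R := k) (A := H)))
    (hconn : 𝒞 0 = LinearMap.range (Algebra.linearMap k H)) :
    ∃ S : H →ₗ[k] H,
      LinearMap.mul' k H ∘ₗ TensorProduct.map S LinearMap.id ∘ₗ Coalgebra.comul
        = Algebra.linearMap k H ∘ₗ Coalgebra.counit ∧
      LinearMap.mul' k H ∘ₗ TensorProduct.map LinearMap.id S ∘ₗ Coalgebra.comul
        = Algebra.linearMap k H ∘ₗ Coalgebra.counit := by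
  let I : WithConv (H →ₗ[k] H) := WithConv.toConv LinearMap.id
  let e : WithConv (H →ₗ[k] H) := 1 - I
  have hI : I = 1 - e := by simp [e]
  have he : ∀ x ∈ 𝒞 0, e x = 0 := by
    intro x hx
    rw [hconn] at hx
    obtain ⟨r, rfl⟩ := hx
    change (1 : WithConv (H →ₗ[k] H)) (algebraMap k H r) - algebraMap k H r = 0
    simp [LinearMap.convOne_apply]
  let G : ℕ → WithConv (H →ₗ[k] H) := fun N => ∑ i ∈ Finset.range N, e ^ i
  have hG : ∀ n N, n < N → ∀ x ∈ 𝒞 n, G N x = G (n + 1) x := by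
    intro n N hn x hx
    induction N, Nat.succ_le_of_lt hn using Nat.le_induction with
    | base => rfl
    | succ N hN ih =>
      have hs : G (N + 1) = G N + e ^ N := Finset.sum_range_succ _ _
      have hz := convPow_apply_eq_zero_of_lt hcomul he hN hx
      rw [hs]
      change G N x + (e ^ N) x = _
      rw [hz, add_zero, ih hN]
  obtain ⟨S, hS⟩ := exists_linearMap_eq_on_isInternal hinternal fun n => (G (n + 1)).ofConv
  have hSG : ∀ n p, p ≤ n → ∀ a ∈ 𝒞 p, S a = G (n + 1) a := fun n p hp a ha =>
    (hS p a ha).trans (hG p (n + 1) (by omega) a ha).symm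
  have hone : ∀ n, ∀ x ∈ 𝒞 n, (1 - e ^ (n + 1)) x = (1 : WithConv (H →ₗ[k] H)) x := by
    intro n x hx
    change (1 : WithConv (H →ₗ[k] H)) x - (e ^ (n + 1)) x = _
    rw [convPow_apply_eq_zero_of_lt hcomul he n.lt_succ_self hx, sub_zero]
  refine ⟨S, linearMap_ext_of_isInternal hinternal fun n x hx => ?_,
    linearMap_ext_of_isInternal hinternal fun n x hx => ?_⟩
  · change (WithConv.toConv S * I) x = (1 : WithConv (H →ₗ[k] H)) x
    rw [convMul_apply_eq_of_mem hcomul hx (WithConv.toConv S) I (G (n + 1)) I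
      fun p q hpq a ha b _ => congrArg (· * I b) (hSG n p (by omega) a ha),
      hI, geom_sum_mul_neg, hone n x hx]
  · change (I * WithConv.toConv S) x = (1 : WithConv (H →ₗ[k] H)) x
    rw [convMul_apply_eq_of_mem hcomul hx I (WithConv.toConv S) I (G (n + 1))
      fun p q hpq a _ b hb => congrArg (I a * ·) (hSG n q (by omega) b hb),
      hI, mul_neg_geom_sum, hone n x hx]
end
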